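/- (Rademacher complexity generalization bound.) Let F be a countable class of classifiers and let δ ∈ (0, 1]. Then with probability at least 1 − δ over the i.i.d. n-sample from P, every f ∈ F satisfies R(f) ≤ R_emp(f) + 2·ℛ(F) + sqrt(log(1/δ) / (2n)), where ℛ(F) = E[ sup_{f ∈ F} (1/n)·∑_{i=1}^{n} σ_i·f(X_i) ] is the Rademacher complexity of F at sample size n, the expectation being over X_1, …, X_n drawn i.i.d. from the marginal of P on 𝒳 and over independent Rademacher variables σ_1, …, σ_n (i.i.d. uniform on {−1, +1}, independent of the sample). -/

import Mathlib

open MeasureTheory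

/-- The risk of a classifier under the 0-1 loss. Labels `{−1,+1}` are encoded as `Bool`
(`true ↦ +1`, `false ↦ −1`). -/
noncomputable def risk {X : Type*} [MeasurableSpace X] (P : Measure (X × Bool))
    (f : X → Bool) : ℝ :=
  (P {p | f p.1 ≠ p.2}).toReal

/-- The empirical risk of a classifier on a sample of `n` labeled points. -/
noncomputable def empRisk {X : Type*} {n : ℕ} (f : X → Bool) (s : Fin n → X × Bool) : ℝ :=
  ((Finset.univ.filter fun i => f (s i).1 ≠ (s i).2).card : ℝ) / n

/-- The `±1` value encoded by a Boolean label. -/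
def pmVal (b : Bool) : ℝ := if b then 1 else -1

/-- The distribution of a single Rademacher variable: uniform on `{−1,+1}` (encoded as
the uniform distribution on `Bool`). -/
noncomputable def radMeasure : Measure Bool := (PMF.uniformOfFintype Bool).toMeasure

/-- The Rademacher complexity of a class `F` at sample size `n`:
`ℛ(F) = E [sup_{f ∈ F} (1/n) ∑ σ_i f(X_i)]`, where `X_1, …, X_n` are i.i.d. from the marginal
of `P` on `𝒳` and `σ_1, …, σ_n` are independent Rademacher variables. -/
noncomputable def rademacherComplexity {X : Type*} [MeasurableSpace X]
    (P : Measure (X × Bool)) (F : Set (X → Bool)) (n : ℕ) : ℝ :=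
  ∫ p, (⨆ f : F, (1 / n : ℝ) * ∑ i, pmVal (p.2 i) * pmVal ((f : X → Bool) (p.1 i)))
    ∂((Measure.pi fun _ : Fin n => P.map Prod.fst).prod
        (Measure.pi fun _ : Fin n => radMeasure))

open ProbabilityTheory Real in
/-- **McDiarmid's inequality**, moment generating function form: a bounded measurable function of
`n` i.i.d. variables that changes by at most `c i` when its `i`-th argument changes is, once
centered, sub-Gaussian with parameter `∑ i, (c i / 2) ^ 2`. -/
theorem hasSubgaussianMGF_pi_of_bounded_differences {Ω : Type*} [MeasurableSpace Ω]
    (μ : Measure Ω) [IsProbabilityMeasure μ] {n : ℕ} {g : (Fin n → Ω) → ℝ} (hg : Measurable g)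
    {C : ℝ} (hC : ∀ s, |g s| ≤ C) {c : Fin n → ℝ}
    (hc : ∀ i s x, g (Function.update s i x) ≤ g s + c i) :
    HasSubgaussianMGF (fun s ↦ g s - ∫ s', g s' ∂(Measure.pi fun _ : Fin n ↦ μ))
      (∑ i, (‖c i‖₊ / 2) ^ 2) (Measure.pi fun _ : Fin n ↦ μ) := by
  have hcenter {m : ℕ} {f : (Fin m → Ω) → ℝ} (hf : Measurable f) {B : ℝ} (hB : ∀ s, |f s| ≤ B)
      (a t : ℝ) : Integrable (fun s ↦ exp (t * (f s - a))) (Measure.pi fun _ : Fin m ↦ μ) := by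
    refine integrable_exp_mul_of_mem_Icc (a := -B - a) (b := B - a) (by fun_prop)
      (ae_of_all _ fun s ↦ ?_)
    have := abs_le.1 (hB s)
    constructor <;> linarith
  refine ⟨hcenter hg hC _, ?_⟩
  induction n with
  | zero =>
    intro t
    have : ∀ s, g s = g default := fun s ↦ congrArg g (Subsingleton.elim _ _)
    simp [mgf, this]
  | succ n ih =>
    intro t
    have : Nonempty Ω := nonempty_of_isProbabilityMeasure μ
    set e := (MeasurableEquiv.piFinSuccAbove (fun _ : Fin (n + 1) ↦ Ω) 0).symm
    have hmp : MeasurePreserving e (μ.prod (Measure.pi fun _ : Fin n ↦ μ))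
        (Measure.pi fun _ : Fin (n + 1) ↦ μ) :=
      (measurePreserving_piFinSuccAbove (fun _ : Fin (n + 1) ↦ μ) 0).symm
    have hecons (x : Ω) (s : Fin n → Ω) : e (x, s) = Fin.cons x s :=
      Fin.insertNth_zero' x s
    have hgcons : Measurable fun p : Ω × (Fin n → Ω) ↦ g (Fin.cons p.1 p.2) := by
      simp only [← hecons]
      exact hg.comp e.measurable
    have hgcons_left (s : Fin n → Ω) : Measurable fun x ↦ g (Fin.cons x s) :=
      hgcons.comp (by fun_prop : Measurable fun x : Ω ↦ (x, s))
    have hgint (s : Fin n → Ω) : Integrable (fun x ↦ g (Fin.cons x s)) μ :=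
      .of_bound (hgcons_left s).aestronglyMeasurable C (ae_of_all _ fun x ↦ hC _)
    set h : (Fin n → Ω) → ℝ := fun s ↦ ∫ x, g (Fin.cons x s) ∂μ with hh
    have hhmeas : Measurable h :=
      (hgcons.stronglyMeasurable.integral_prod_left').measurable
    have hhC (s) : |h s| ≤ C := by
      simpa using norm_integral_le_of_norm_le_const (μ := μ)
        (f := fun x ↦ g (Fin.cons x s)) (ae_of_all _ fun x ↦ hC _)
    have hhc (i : Fin n) (s : Fin n → Ω) (x : Ω) :
        h (Function.update s i x) ≤ h s + c i.succ := by
      calc h (Function.update s i x) ≤ ∫ y, (g (Fin.cons y s) + c i.succ) ∂μ := by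
            refine integral_mono (hgint _) ((hgint s).add (integrable_const _)) fun y ↦ ?_
            simp only [Fin.cons_update]
            exact hc _ _ _
        _ = h s + c i.succ := by
            rw [integral_add (hgint s) (integrable_const _)]; simp [hh]
    have hgh : ∫ s, g s ∂(Measure.pi fun _ : Fin (n + 1) ↦ μ)
        = ∫ s, h s ∂(Measure.pi fun _ : Fin n ↦ μ) := by
      rw [← hmp.integral_comp', integral_prod_symm]
      · simp only [hecons, hh]
      · exact .of_bound (hg.comp e.measurable).aestronglyMeasurable C (ae_of_all _ fun x ↦ hC _)
    have hslice (s : Fin n → Ω) :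
        mgf (fun x ↦ g (Fin.cons x s) - h s) μ t ≤ exp ((‖c 0‖₊ / 2) ^ 2 * t ^ 2 / 2) := by
      have hbdd : BddBelow (Set.range fun x ↦ g (Fin.cons x s)) :=
        ⟨-C, by rintro _ ⟨x, rfl⟩; exact (abs_le.1 (hC _)).1⟩
      have := (hasSubgaussianMGF_of_mem_Icc (μ := μ) (X := fun x ↦ g (Fin.cons x s))
        (a := ⨅ x, g (Fin.cons x s)) (b := (⨅ x, g (Fin.cons x s)) + c 0)
        (hgcons_left s).aemeasurable (ae_of_all _ fun x ↦ ⟨ciInf_le hbdd x, ?_⟩)).mgf_le t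
      · simpa [add_sub_cancel_left] using this
      · rw [← sub_le_iff_le_add]
        refine le_ciInf fun y ↦ ?_
        have := hc 0 (Fin.cons y s) x
        rw [Fin.update_cons_zero] at this
        linarith
    set m := ∫ s, h s ∂(Measure.pi fun _ : Fin n ↦ μ)
    have hint := hcenter hhmeas hhC m t
    calc mgf (fun s ↦ g s - ∫ s', g s' ∂(Measure.pi fun _ ↦ μ)) (Measure.pi fun _ ↦ μ) t
        = ∫ s, mgf (fun x ↦ g (Fin.cons x s) - h s) μ t * exp (t * (h s - m))
            ∂(Measure.pi fun _ : Fin n ↦ μ) := by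
          rw [mgf, hgh, ← hmp.integral_comp', integral_prod_symm]
          · simp only [hecons, mgf, ← integral_mul_const, ← exp_add, ← mul_add,
              sub_add_sub_cancel]
          · exact hmp.integrable_comp_of_integrable (hcenter hg hC m t)
      _ ≤ ∫ s, exp ((‖c 0‖₊ / 2) ^ 2 * t ^ 2 / 2) * exp (t * (h s - m))
            ∂(Measure.pi fun _ : Fin n ↦ μ) := by
          refine integral_mono_of_nonneg (ae_of_all _ fun s ↦ ?_) (hint.const_mul _)
            (ae_of_all _ fun s ↦ ?_)
          · exact mul_nonneg mgf_nonneg (exp_nonneg _)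
          · exact mul_le_mul_of_nonneg_right (hslice s) (exp_nonneg _)
      _ ≤ exp ((‖c 0‖₊ / 2) ^ 2 * t ^ 2 / 2)
            * exp ((∑ i : Fin n, (‖c i.succ‖₊ / 2) ^ 2 : NNReal) * t ^ 2 / 2) := by
          rw [integral_const_mul]
          exact mul_le_mul_of_nonneg_left (ih hhmeas hhC hhc t) (exp_nonneg _)
      _ = _ := by
          rw [← exp_add, Fin.sum_univ_succ]
          push_cast
          ring_nf

theorem bddAbove_range_of_abs_le {ι : Type*} {u : ι → ℝ} {C : ℝ} (h : ∀ i, |u i| ≤ C) :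
    BddAbove (Set.range u) :=
  ⟨C, by rintro _ ⟨i, rfl⟩; exact (abs_le.1 (h i)).2⟩

theorem abs_ciSup_le {ι : Type*} [Nonempty ι] {u : ι → ℝ} {C : ℝ} (h : ∀ i, |u i| ≤ C) :
    |⨆ i, u i| ≤ C := by
  obtain ⟨i⟩ := ‹Nonempty ι›
  exact abs_le.2 ⟨(abs_le.1 (h i)).1.trans (le_ciSup (bddAbove_range_of_abs_le h) i),
    ciSup_le fun i ↦ (abs_le.1 (h i)).2⟩

@[fun_prop]
theorem measurable_pmVal : Measurable pmVal := .of_discrete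

theorem abs_pmVal (b : Bool) : |pmVal b| = 1 := by cases b <;> simp [pmVal]

theorem pmVal_beq (a b : Bool) : pmVal (a == b) = pmVal a * pmVal b := by
  cases a <;> cases b <;> simp [pmVal]

theorem pmVal_not (b : Bool) : pmVal (!b) = -pmVal b := by cases b <;> simp [pmVal]

/-- The 0-1 loss of a classifier at a labeled point. -/
noncomputable def zeroOneLoss {X : Type*} (f : X → Bool) (p : X × Bool) : ℝ :=
  (1 - pmVal p.2 * pmVal (f p.1)) / 2

theorem zeroOneLoss_eq_ite {X : Type*} (f : X → Bool) (p : X × Bool) :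
    zeroOneLoss f p = if f p.1 ≠ p.2 then 1 else 0 := by
  rcases p with ⟨x, b⟩
  rcases h : f x <;> cases b <;> norm_num [zeroOneLoss, pmVal, h]

theorem zeroOneLoss_mem_Icc {X : Type*} (f : X → Bool) (p : X × Bool) :
    zeroOneLoss f p ∈ Set.Icc (0 : ℝ) 1 := by
  rw [zeroOneLoss_eq_ite]
  split_ifs <;> simp

@[fun_prop]
theorem measurable_zeroOneLoss {X : Type*} [MeasurableSpace X] {f : X → Bool}
    (hf : Measurable f) : Measurable (zeroOneLoss f) := by
  unfold zeroOneLoss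
  fun_prop

theorem risk_eq_integral_zeroOneLoss {X : Type*} [MeasurableSpace X] (P : Measure (X × Bool))
    {f : X → Bool} (hf : Measurable f) : risk P f = ∫ p, zeroOneLoss f p ∂P := by
  have hs : MeasurableSet {p : X × Bool | f p.1 ≠ p.2} :=
    (measurableSet_eq_fun (hf.comp measurable_fst) measurable_snd).compl
  calc risk P f = ∫ p, {p : X × Bool | f p.1 ≠ p.2}.indicator 1 p ∂P :=
        (integral_indicator_one hs).symm
    _ = ∫ p, zeroOneLoss f p ∂P := by
        congr with p
        simp [zeroOneLoss_eq_ite, Set.indicator_apply]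

section EmpiricalRisk

variable {X : Type*} {n : ℕ}

theorem empRisk_eq_sum (f : X → Bool) (s : Fin n → X × Bool) :
    empRisk f s = (1 / n : ℝ) * ∑ i, zeroOneLoss f (s i) := by
  simp only [empRisk, zeroOneLoss_eq_ite, Finset.sum_boole]
  ring

theorem empRisk_mem_Icc (f : X → Bool) (s : Fin n → X × Bool) :
    empRisk f s ∈ Set.Icc (0 : ℝ) 1 := by
  refine ⟨by unfold empRisk; positivity, div_le_one_of_le₀ ?_ n.cast_nonneg⟩
  exact_mod_cast (Finset.card_le_univ _).trans_eq (Fintype.card_fin n)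

theorem empRisk_le_empRisk_update (f : X → Bool) (s : Fin n → X × Bool) (i : Fin n)
    (p : X × Bool) : empRisk f s ≤ empRisk f (Function.update s i p) + 1 / n := by
  have h : ∑ j, zeroOneLoss f (s j) ≤ ∑ j, zeroOneLoss f (Function.update s i p j) + 1 := by
    have hne : ∑ j ∈ Finset.univ.erase i, zeroOneLoss f (Function.update s i p j)
        = ∑ j ∈ Finset.univ.erase i, zeroOneLoss f (s j) :=
      Finset.sum_congr rfl fun j hj ↦ by rw [Function.update_of_ne (Finset.ne_of_mem_erase hj)]
    rw [← Finset.add_sum_erase _ _ (Finset.mem_univ i),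
      ← Finset.add_sum_erase (a := i) _ (fun j ↦ zeroOneLoss f (Function.update s i p j))
        (Finset.mem_univ i), hne]
    have h₁ := (zeroOneLoss_mem_Icc f (s i)).2
    have h₀ := (zeroOneLoss_mem_Icc f (Function.update s i p i)).1
    linarith
  rw [empRisk_eq_sum, empRisk_eq_sum, ← mul_add_one]
  gcongr

theorem abs_empRisk_sub_empRisk_le (f : X → Bool) (s s' : Fin n → X × Bool) :
    |empRisk f s' - empRisk f s| ≤ 1 := by
  have h := empRisk_mem_Icc f s
  have h' := empRisk_mem_Icc f s'
  exact abs_le.2 ⟨by linarith [h.2, h'.1], by linarith [h.1, h'.2]⟩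

variable [MeasurableSpace X]

theorem measurable_empRisk {f : X → Bool} (hf : Measurable f) :
    Measurable (empRisk f : (Fin n → X × Bool) → ℝ) := by
  simp only [funext (empRisk_eq_sum f)]
  fun_prop

variable (P : Measure (X × Bool)) [IsProbabilityMeasure P]

theorem abs_risk_sub_empRisk_le (f : X → Bool) (s : Fin n → X × Bool) :
    |risk P f - empRisk f s| ≤ 1 := by
  have h := empRisk_mem_Icc f s
  have h₀ : 0 ≤ risk P f := ENNReal.toReal_nonneg
  have h₁ : risk P f ≤ 1 := measureReal_le_one
  exact abs_le.2 ⟨by linarith [h.2], by linarith [h.1]⟩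

theorem integrable_empRisk {f : X → Bool} (hf : Measurable f) :
    Integrable (empRisk f) (Measure.pi fun _ : Fin n ↦ P) :=
  .of_bound (measurable_empRisk hf).aestronglyMeasurable 1 <| ae_of_all _ fun s ↦ by
    rw [Real.norm_of_nonneg (empRisk_mem_Icc f s).1]
    exact (empRisk_mem_Icc f s).2

theorem integral_empRisk {f : X → Bool} (hf : Measurable f) (hn : 0 < n) :
    ∫ s, empRisk f s ∂(Measure.pi fun _ : Fin n ↦ P) = risk P f := by
  have hloss (i : Fin n) : ∫ s, zeroOneLoss f (s i) ∂(Measure.pi fun _ : Fin n ↦ P)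
      = risk P f := by
    rw [risk_eq_integral_zeroOneLoss P hf]
    conv_rhs => rw [← (measurePreserving_eval (fun _ : Fin n ↦ P) i).map_eq]
    exact (integral_map (measurable_pi_apply i).aemeasurable
      (measurable_zeroOneLoss hf).aestronglyMeasurable).symm
  have hint (i : Fin n) : Integrable (fun s : Fin n → X × Bool ↦ zeroOneLoss f (s i))
      (Measure.pi fun _ : Fin n ↦ P) :=
    .of_bound ((measurable_zeroOneLoss hf).comp (measurable_pi_apply i)).aestronglyMeasurable 1 <|
      ae_of_all _ fun s ↦ by
      rw [Real.norm_of_nonneg (zeroOneLoss_mem_Icc f (s i)).1]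
      exact (zeroOneLoss_mem_Icc f (s i)).2
  simp only [empRisk_eq_sum]
  rw [integral_const_mul, integral_finsetSum _ fun i _ ↦ hint i]
  simp [hloss, hn.ne']

end EmpiricalRisk

section Symmetrization

variable {X : Type*} {n : ℕ}

/-- The supremum over `f ∈ F` of the correlation of `f` with the signs `σ` on the points `x`. -/
noncomputable def supCorrelation (F : Set (X → Bool)) (σ : Fin n → Bool) (x : Fin n → X) : ℝ :=
  ⨆ f : F, (1 / n : ℝ) * ∑ i, pmVal (σ i) * pmVal ((f : X → Bool) (x i))

theorem abs_correlation_le (f : X → Bool) (σ : Fin n → Bool) (x : Fin n → X) :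
    |(1 / n : ℝ) * ∑ i, pmVal (σ i) * pmVal (f (x i))| ≤ 1 := by
  rw [abs_mul, abs_of_nonneg (by positivity)]
  calc (1 / n : ℝ) * |∑ i, pmVal (σ i) * pmVal (f (x i))|
      ≤ (1 / n : ℝ) * ∑ i : Fin n, |pmVal (σ i) * pmVal (f (x i))| := by
        gcongr
        exact Finset.abs_sum_le_sum_abs _ _
    _ ≤ 1 := by simpa [abs_mul, abs_pmVal] using inv_mul_le_one

theorem correlation_le_supCorrelation {F : Set (X → Bool)} {f : X → Bool} (hf : f ∈ F)
    (σ : Fin n → Bool) (x : Fin n → X) :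
    (1 / n : ℝ) * ∑ i, pmVal (σ i) * pmVal (f (x i)) ≤ supCorrelation F σ x :=
  le_ciSup (f := fun f : F ↦ (1 / n : ℝ) * ∑ i, pmVal (σ i) * pmVal ((f : X → Bool) (x i)))
    (bddAbove_range_of_abs_le fun _ ↦ abs_correlation_le _ σ x) ⟨f, hf⟩

theorem abs_supCorrelation_le {F : Set (X → Bool)} (hF : F.Nonempty) (σ : Fin n → Bool)
    (x : Fin n → X) : |supCorrelation F σ x| ≤ 1 :=
  have := hF.to_subtype
  abs_ciSup_le fun _ ↦ abs_correlation_le _ σ x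

/-- The correlation of `F` with the labels of a sample multiplied by the signs `σ`. -/
noncomputable def labeledCorrelation (F : Set (X → Bool)) (σ : Fin n → Bool)
    (s : Fin n → X × Bool) : ℝ :=
  supCorrelation F (fun i ↦ σ i == (s i).2) fun i ↦ (s i).1

/-- Exchanging the `i`-th entries of two samples for every `i` with `σ i = false`. -/
def swapSamples {Z : Type*} (σ : Fin n → Bool) (w : (Fin n → Z) × (Fin n → Z)) :
    (Fin n → Z) × (Fin n → Z) :=
  (fun i ↦ bif σ i then w.1 i else w.2 i, fun i ↦ bif σ i then w.2 i else w.1 i)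

theorem empRisk_sub_swapSamples_eq (f : X → Bool) (σ : Fin n → Bool)
    (w : (Fin n → X × Bool) × (Fin n → X × Bool)) :
    empRisk f (swapSamples σ w).2 - empRisk f (swapSamples σ w).1
      = ((1 / n : ℝ) * ∑ i, pmVal (σ i == (w.1 i).2) * pmVal (f (w.1 i).1)
        + (1 / n : ℝ) * ∑ i, pmVal ((!σ i) == (w.2 i).2) * pmVal (f (w.2 i).1)) / 2 := by
  rw [empRisk_eq_sum, empRisk_eq_sum, ← mul_sub, ← mul_add, mul_div_assoc,
    ← Finset.sum_sub_distrib, ← Finset.sum_add_distrib, Finset.sum_div]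
  congr 1
  refine Finset.sum_congr rfl fun i _ ↦ ?_
  have htrue : pmVal true = 1 := rfl
  have hfalse : pmVal false = -1 := rfl
  simp only [swapSamples, pmVal_beq, pmVal_not, zeroOneLoss]
  cases σ i <;> simp only [cond_true, cond_false, htrue, hfalse] <;> ring

variable [MeasurableSpace X]

theorem measurable_supCorrelation {F : Set (X → Bool)} (hFc : F.Countable)
    (hFmeas : ∀ f ∈ F, Measurable f) :
    Measurable fun p : (Fin n → X) × (Fin n → Bool) ↦ supCorrelation F p.2 p.1 := by
  have := hFc.to_subtype
  refine .iSup fun f ↦ ?_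
  have := hFmeas f f.2
  fun_prop

instance : IsProbabilityMeasure radMeasure := by
  unfold radMeasure; infer_instance

theorem measurePreserving_radMeasure (e : Bool ≃ Bool) :
    MeasurePreserving e radMeasure radMeasure := by
  refine ⟨.of_discrete, Measure.ext_of_singleton fun b ↦ ?_⟩
  rw [Measure.map_apply .of_discrete (.singleton b), ← e.image_symm_eq_preimage,
    Set.image_singleton]
  simp [radMeasure]

/-- Flipping Rademacher signs by bijections of `Bool` does not change expectations. -/
theorem integral_radMeasure_comp (e : Fin n → Bool ≃ Bool) (u : (Fin n → Bool) → ℝ) :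
    ∫ σ, u (fun i ↦ e i (σ i)) ∂(Measure.pi fun _ : Fin n ↦ radMeasure)
      = ∫ σ, u σ ∂(Measure.pi fun _ : Fin n ↦ radMeasure) := by
  have h := measurePreserving_pi (fun _ : Fin n ↦ radMeasure) (fun _ : Fin n ↦ radMeasure)
    fun i ↦ measurePreserving_radMeasure (e i)
  conv_rhs => rw [← h.map_eq]
  exact (integral_map h.measurable.aemeasurable
    (Measurable.of_discrete (f := u)).aestronglyMeasurable).symm

/-- Sign change by a label, as a bijection of `Bool`. -/
def beqEquiv (b : Bool) : Bool ≃ Bool where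
  toFun a := a == b
  invFun a := a == b
  left_inv a := by cases a <;> cases b <;> rfl
  right_inv a := by cases a <;> cases b <;> rfl

theorem measurePreserving_swapSamples {Z : Type*} [MeasurableSpace Z] (μ : Measure Z)
    [IsProbabilityMeasure μ] (σ : Fin n → Bool) :
    MeasurePreserving (swapSamples σ)
      ((Measure.pi fun _ : Fin n ↦ μ).prod (Measure.pi fun _ : Fin n ↦ μ))
      ((Measure.pi fun _ : Fin n ↦ μ).prod (Measure.pi fun _ : Fin n ↦ μ)) := by
  have he := measurePreserving_arrowProdEquivProdArrow Z Z (Fin n) (fun _ ↦ μ) (fun _ ↦ μ)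
  have hswap (b : Bool) : MeasurePreserving
      (fun z : Z × Z ↦ bif b then z else z.swap) (μ.prod μ) (μ.prod μ) := by
    cases b
    · exact Measure.measurePreserving_swap
    · exact .id _
  have h := (he.comp (measurePreserving_pi _ _ fun i ↦ hswap (σ i))).comp he.symm
  convert h using 1
  funext w
  refine Prod.ext (funext fun i ↦ ?_) (funext fun i ↦ ?_) <;>
    cases hi : σ i <;>
    simp [swapSamples, hi, MeasurableEquiv.arrowProdEquivProdArrow, Equiv.arrowProdEquivProdArrow]

variable (P : Measure (X × Bool)) [IsProbabilityMeasure P] {F : Set (X → Bool)}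

theorem integrable_iSup_empRisk_sub (hF : F.Nonempty) (hFc : F.Countable)
    (hFmeas : ∀ f ∈ F, Measurable f) :
    Integrable (fun w : (Fin n → X × Bool) × (Fin n → X × Bool) ↦
        ⨆ f : F, (empRisk (f : X → Bool) w.2 - empRisk (f : X → Bool) w.1))
      ((Measure.pi fun _ ↦ P).prod (Measure.pi fun _ ↦ P)) := by
  have := hFc.to_subtype
  have := hF.to_subtype
  refine .of_bound (Measurable.iSup fun f ↦ ?_).aestronglyMeasurable 1
    (ae_of_all _ fun w ↦ abs_ciSup_le fun f ↦ abs_empRisk_sub_empRisk_le _ _ _)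
  have := measurable_empRisk (n := n) (hFmeas f f.2)
  fun_prop

/-- Replacing the risk by the empirical risk on an independent ghost sample. -/
theorem integral_iSup_risk_sub_le_ghost (hF : F.Nonempty) (hFc : F.Countable)
    (hFmeas : ∀ f ∈ F, Measurable f) (hn : 0 < n) :
    ∫ s, ⨆ f : F, (risk P (f : X → Bool) - empRisk (f : X → Bool) s)
        ∂(Measure.pi fun _ : Fin n ↦ P)
      ≤ ∫ w, ⨆ f : F, (empRisk (f : X → Bool) w.2 - empRisk (f : X → Bool) w.1)
        ∂((Measure.pi fun _ : Fin n ↦ P).prod (Measure.pi fun _ : Fin n ↦ P)) := by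
  have := hFc.to_subtype
  have := hF.to_subtype
  have hint := integrable_iSup_empRisk_sub (n := n) P hF hFc hFmeas
  rw [integral_prod _ hint]
  refine integral_mono (.of_bound (Measurable.iSup fun f ↦ ?_).aestronglyMeasurable 1
    (ae_of_all _ fun s ↦ abs_ciSup_le fun f ↦ abs_risk_sub_empRisk_le P _ s))
    hint.integral_prod_left fun s ↦ ciSup_le fun f ↦ ?_
  · exact measurable_const.sub (measurable_empRisk (hFmeas f f.2))
  have hf := integrable_empRisk (n := n) P (hFmeas f f.2)
  calc risk P (f : X → Bool) - empRisk (f : X → Bool) s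
      = ∫ s', (empRisk (f : X → Bool) s' - empRisk (f : X → Bool) s)
          ∂(Measure.pi fun _ : Fin n ↦ P) := by
        rw [integral_sub hf (integrable_const _), integral_empRisk P (hFmeas f f.2) hn]
        simp
    _ ≤ _ := by
        refine integral_mono (hf.sub (integrable_const _)) (.of_bound
          (Measurable.iSup fun g ↦ ?_).aestronglyMeasurable 1
          (ae_of_all _ fun s' ↦ abs_ciSup_le fun g ↦ abs_empRisk_sub_empRisk_le _ _ _))
          fun s' ↦ le_ciSup (f := fun g : F ↦ empRisk (g : X → Bool) s' - empRisk (g : X → Bool) s)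
            (bddAbove_range_of_abs_le fun g ↦ abs_empRisk_sub_empRisk_le _ _ _) f
        exact (measurable_empRisk (hFmeas g g.2)).sub_const (empRisk (g : X → Bool) s)

theorem measurable_labeledCorrelation (hFc : F.Countable) (hFmeas : ∀ f ∈ F, Measurable f) :
    Measurable fun p : (Fin n → X × Bool) × (Fin n → Bool) ↦ labeledCorrelation F p.2 p.1 := by
  refine (measurable_supCorrelation hFc hFmeas).comp
    (f := fun p : (Fin n → X × Bool) × (Fin n → Bool) ↦
      ((fun i ↦ (p.1 i).1 : Fin n → X), (fun i ↦ p.2 i == (p.1 i).2 : Fin n → Bool)))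
    (.prodMk (by fun_prop) (measurable_pi_lambda _ fun i ↦ ?_))
  exact (Measurable.of_discrete (f := fun q : Bool × Bool ↦ q.1 == q.2)).comp
    (by fun_prop : Measurable fun p : (Fin n → X × Bool) × (Fin n → Bool) ↦ (p.2 i, (p.1 i).2))

theorem integrable_labeledCorrelation (hF : F.Nonempty) (hFc : F.Countable)
    (hFmeas : ∀ f ∈ F, Measurable f) :
    Integrable (fun p : (Fin n → X × Bool) × (Fin n → Bool) ↦ labeledCorrelation F p.2 p.1)
      ((Measure.pi fun _ ↦ P).prod (Measure.pi fun _ ↦ radMeasure)) :=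
  .of_bound (measurable_labeledCorrelation hFc hFmeas).aestronglyMeasurable 1
    (ae_of_all _ fun _ ↦ abs_supCorrelation_le hF _ _)

theorem integral_labeledCorrelation (hF : F.Nonempty) (hFc : F.Countable)
    (hFmeas : ∀ f ∈ F, Measurable f) :
    ∫ σ, ∫ s, labeledCorrelation F σ s ∂(Measure.pi fun _ : Fin n ↦ P)
        ∂(Measure.pi fun _ : Fin n ↦ radMeasure)
      = rademacherComplexity P F n := by
  have hfst : MeasurePreserving Prod.fst P (P.map Prod.fst) := ⟨measurable_fst, rfl⟩
  have : IsProbabilityMeasure (P.map Prod.fst) :=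
    Measure.isProbabilityMeasure_map measurable_fst.aemeasurable
  have hmp := measurePreserving_pi (fun _ : Fin n ↦ P) (fun _ : Fin n ↦ P.map Prod.fst)
    fun _ ↦ hfst
  have hmeas := measurable_supCorrelation (n := n) hFc hFmeas
  calc ∫ σ, ∫ s, labeledCorrelation F σ s ∂(Measure.pi fun _ : Fin n ↦ P)
        ∂(Measure.pi fun _ : Fin n ↦ radMeasure)
      = ∫ s, ∫ σ, labeledCorrelation F σ s ∂(Measure.pi fun _ : Fin n ↦ radMeasure)
        ∂(Measure.pi fun _ : Fin n ↦ P) :=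
        (integral_integral_swap (f := fun s σ ↦ labeledCorrelation F σ s)
          (integrable_labeledCorrelation P hF hFc hFmeas)).symm
    _ = ∫ s : Fin n → X × Bool, ∫ σ, supCorrelation F σ (fun i ↦ (s i).1)
        ∂(Measure.pi fun _ : Fin n ↦ radMeasure) ∂(Measure.pi fun _ : Fin n ↦ P) := by
        congr with s
        exact integral_radMeasure_comp (fun i ↦ beqEquiv (s i).2)
          fun σ ↦ supCorrelation F σ fun i ↦ (s i).1
    _ = ∫ x : Fin n → X, ∫ σ, supCorrelation F σ x ∂(Measure.pi fun _ : Fin n ↦ radMeasure)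
        ∂(Measure.pi fun _ : Fin n ↦ P.map Prod.fst) := by
        rw [← hmp.map_eq, integral_map hmp.measurable.aemeasurable
          hmeas.stronglyMeasurable.integral_prod_right'.aestronglyMeasurable]
    _ = rademacherComplexity P F n := by
        refine (integral_prod _ (.of_bound hmeas.aestronglyMeasurable 1
          (ae_of_all _ fun p ↦ abs_supCorrelation_le hF p.2 p.1))).symm

theorem integral_ghost_le_labeledCorrelation (hF : F.Nonempty) (hFc : F.Countable)
    (hFmeas : ∀ f ∈ F, Measurable f) (σ : Fin n → Bool) :
    ∫ w, ⨆ f : F, (empRisk (f : X → Bool) w.2 - empRisk (f : X → Bool) w.1)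
        ∂((Measure.pi fun _ : Fin n ↦ P).prod (Measure.pi fun _ : Fin n ↦ P))
      ≤ (∫ s, labeledCorrelation F σ s ∂(Measure.pi fun _ : Fin n ↦ P)
        + ∫ s, labeledCorrelation F (fun i ↦ !σ i) s ∂(Measure.pi fun _ : Fin n ↦ P)) / 2 := by
  have := hF.to_subtype
  have hint := integrable_iSup_empRisk_sub (n := n) P hF hFc hFmeas
  have hmp := measurePreserving_swapSamples P σ
  have hlab (τ : Fin n → Bool) :
      Integrable (labeledCorrelation F τ) (Measure.pi fun _ : Fin n ↦ P) :=
    .of_bound ((measurable_labeledCorrelation hFc hFmeas).comp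
      (measurable_id.prodMk measurable_const)).aestronglyMeasurable 1
      (ae_of_all _ fun _ ↦ abs_supCorrelation_le hF _ _)
  have h₁ := (hlab σ).comp_fst (Measure.pi fun _ : Fin n ↦ P)
  have h₂ := (hlab fun i ↦ !σ i).comp_snd (Measure.pi fun _ : Fin n ↦ P)
  calc ∫ w, ⨆ f : F, (empRisk (f : X → Bool) w.2 - empRisk (f : X → Bool) w.1)
        ∂((Measure.pi fun _ : Fin n ↦ P).prod (Measure.pi fun _ : Fin n ↦ P))
      = ∫ w, ⨆ f : F, (empRisk (f : X → Bool) (swapSamples σ w).2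
          - empRisk (f : X → Bool) (swapSamples σ w).1)
        ∂((Measure.pi fun _ : Fin n ↦ P).prod (Measure.pi fun _ : Fin n ↦ P)) := by
        conv_lhs => rw [← hmp.map_eq]
        exact integral_map hmp.measurable.aemeasurable (by rw [hmp.map_eq]; exact hint.1)
    _ ≤ ∫ w, (labeledCorrelation F σ w.1 + labeledCorrelation F (fun i ↦ !σ i) w.2) / 2
        ∂((Measure.pi fun _ : Fin n ↦ P).prod (Measure.pi fun _ : Fin n ↦ P)) := by
        refine integral_mono (hmp.integrable_comp_of_integrable hint) ((h₁.add h₂).div_const 2)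
          fun w ↦ ciSup_le fun f ↦ ?_
        rw [empRisk_sub_swapSamples_eq]
        gcongr <;> exact correlation_le_supCorrelation f.2 _ _
    _ = _ := by
        rw [integral_div, integral_add h₁ h₂,
          integral_fun_fst (μ := Measure.pi fun _ : Fin n ↦ P) (labeledCorrelation F σ),
          integral_fun_snd (μ := Measure.pi fun _ : Fin n ↦ P)
            (labeledCorrelation F fun i ↦ !σ i)]
        simp

/-- **Symmetrization**: the expected uniform deviation of the risk from the empirical risk is at
most the Rademacher complexity. -/
theorem integral_iSup_risk_sub_le_rademacherComplexity (hF : F.Nonempty) (hFc : F.Countable)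
    (hFmeas : ∀ f ∈ F, Measurable f) (hn : 0 < n) :
    ∫ s, ⨆ f : F, (risk P (f : X → Bool) - empRisk (f : X → Bool) s)
        ∂(Measure.pi fun _ : Fin n ↦ P) ≤ rademacherComplexity P F n := by
  refine (integral_iSup_risk_sub_le_ghost P hF hFc hFmeas hn).trans ?_
  set A : (Fin n → Bool) → ℝ :=
    fun σ ↦ ∫ s, labeledCorrelation F σ s ∂(Measure.pi fun _ : Fin n ↦ P)
  have hAσ : ∫ σ, A σ ∂(Measure.pi fun _ : Fin n ↦ radMeasure) = rademacherComplexity P F n :=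
    integral_labeledCorrelation P hF hFc hFmeas
  have hAnot : ∫ σ, A (fun i ↦ !σ i) ∂(Measure.pi fun _ : Fin n ↦ radMeasure)
      = rademacherComplexity P F n :=
    (integral_radMeasure_comp (fun _ ↦ Equiv.boolNot) A).trans hAσ
  set D := ∫ w, ⨆ f : F, (empRisk (f : X → Bool) w.2 - empRisk (f : X → Bool) w.1)
    ∂((Measure.pi fun _ : Fin n ↦ P).prod (Measure.pi fun _ : Fin n ↦ P))
  have hD (σ : Fin n → Bool) : D ≤ (A σ + A fun i ↦ !σ i) / 2 :=
    integral_ghost_le_labeledCorrelation P hF hFc hFmeas σ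
  clear_value A D
  calc D = ∫ _, D ∂(Measure.pi fun _ : Fin n ↦ radMeasure) := by simp
    _ ≤ ∫ σ, (A σ + A fun i ↦ !σ i) / 2 ∂(Measure.pi fun _ : Fin n ↦ radMeasure) :=
        integral_mono .of_finite .of_finite hD
    _ = rademacherComplexity P F n := by
        rw [integral_div, integral_add .of_finite .of_finite, hAσ, hAnot, add_self_div_two]

theorem rademacherComplexity_nonneg (hF : F.Nonempty) (hFc : F.Countable)
    (hFmeas : ∀ f ∈ F, Measurable f) : 0 ≤ rademacherComplexity P F n := by
  obtain ⟨f, hf⟩ := hF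
  have hpm (σ : Fin n → Bool) (x : Fin n → X) :
      0 ≤ supCorrelation F σ x + supCorrelation F (fun i ↦ !σ i) x := by
    have h := add_le_add (correlation_le_supCorrelation hf σ x)
      (correlation_le_supCorrelation hf (fun i ↦ !σ i) x)
    simpa [pmVal_not] using h
  have : IsProbabilityMeasure (P.map Prod.fst) :=
    Measure.isProbabilityMeasure_map measurable_fst.aemeasurable
  have hint : Integrable (fun p : (Fin n → X) × (Fin n → Bool) ↦ supCorrelation F p.2 p.1)
      ((Measure.pi fun _ ↦ P.map Prod.fst).prod (Measure.pi fun _ ↦ radMeasure)) :=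
    .of_bound (measurable_supCorrelation hFc hFmeas).aestronglyMeasurable 1
      (ae_of_all _ fun _ ↦ abs_supCorrelation_le ⟨f, hf⟩ _ _)
  change 0 ≤ ∫ p : (Fin n → X) × (Fin n → Bool), supCorrelation F p.2 p.1 ∂_
  rw [integral_prod _ hint]
  refine integral_nonneg fun x ↦ ?_
  have hnot := integral_radMeasure_comp (fun _ : Fin n ↦ Equiv.boolNot)
    fun σ ↦ supCorrelation F σ x
  have h : 0 ≤ ∫ σ, (supCorrelation F σ x + supCorrelation F (fun i ↦ !σ i) x)
      ∂(Measure.pi fun _ : Fin n ↦ radMeasure) := integral_nonneg fun σ ↦ hpm σ x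
  simp only [Equiv.boolNot_apply] at hnot
  rw [integral_add .of_finite .of_finite, hnot] at h
  simpa using h

end Symmetrization

open ProbabilityTheory in
/-- The uniform deviation of the risk from the empirical risk is, once centered, sub-Gaussian. -/
theorem hasSubgaussianMGF_iSup_risk_sub {X : Type*} [MeasurableSpace X]
    (P : Measure (X × Bool)) [IsProbabilityMeasure P] {F : Set (X → Bool)} (hF : F.Nonempty)
    (hFc : F.Countable) (hFmeas : ∀ f ∈ F, Measurable f) (n : ℕ) :
    HasSubgaussianMGF
      (fun s ↦ (⨆ f : F, (risk P (f : X → Bool) - empRisk (f : X → Bool) s))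
        - ∫ s', ⨆ f : F, (risk P (f : X → Bool) - empRisk (f : X → Bool) s')
          ∂(Measure.pi fun _ : Fin n ↦ P))
      (∑ _ : Fin n, (‖(1 / n : ℝ)‖₊ / 2) ^ 2) (Measure.pi fun _ : Fin n ↦ P) := by
  have := hFc.to_subtype
  have := hF.to_subtype
  have hbound (s : Fin n → X × Bool) (f : F) := abs_risk_sub_empRisk_le P (f : X → Bool) s
  refine hasSubgaussianMGF_pi_of_bounded_differences P (.iSup fun f ↦ ?_)
    (fun s ↦ abs_ciSup_le (hbound s)) fun i s p ↦ ciSup_le fun f ↦ ?_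
  · exact measurable_const.sub (measurable_empRisk (hFmeas f f.2))
  · have h := le_ciSup (bddAbove_range_of_abs_le (hbound s)) f
    have hupd := empRisk_le_empRisk_update (f : X → Bool) s i p
    linarith
/-- **Rademacher complexity generalization bound.** For a countable class `F` of classifiers
and `δ ∈ (0,1]`, with probability at least `1 − δ` over the i.i.d. `n`-sample from `P`, every
`f ∈ F` satisfies `R(f) ≤ R_emp(f) + 2 ℛ(F) + sqrt(log(1/δ) / (2n))`. -/
theorem rademacher_generalization_bound {X : Type*} [MeasurableSpace X]
    (P : Measure (X × Bool)) [IsProbabilityMeasure P]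
    (F : Set (X → Bool)) (hFc : F.Countable) (hFmeas : ∀ f ∈ F, Measurable f)
    (n : ℕ) (hn : 0 < n) (δ : ℝ) (hδ0 : 0 < δ) (hδ1 : δ ≤ 1) :
    1 - δ ≤ ((Measure.pi fun _ : Fin n => P)
        {s | ∀ f ∈ F,
            risk P f ≤ empRisk f s + 2 * rademacherComplexity P F n +
              Real.sqrt (Real.log (1 / δ) / (2 * n))}).toReal := by
  rcases F.eq_empty_or_nonempty with rfl | hF
  · simpa using hδ0.le
  have := hF.to_subtype
  set ε := Real.sqrt (Real.log (1 / δ) / (2 * n)) with hε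
  set φ : (Fin n → X × Bool) → ℝ :=
    fun s ↦ ⨆ f : F, (risk P (f : X → Bool) - empRisk (f : X → Bool) s)
  set π := Measure.pi fun _ : Fin n ↦ P
  set S := {s : Fin n → X × Bool |
    ∀ f ∈ F, risk P f ≤ empRisk f s + 2 * rademacherComplexity P F n + ε} with hS
  have hn' : (0 : ℝ) < n := by exact_mod_cast hn
  have hE : ∫ s, φ s ∂π ≤ rademacherComplexity P F n :=
    integral_iSup_risk_sub_le_rademacherComplexity P hF hFc hFmeas hn
  have hR : 0 ≤ rademacherComplexity P F n := rademacherComplexity_nonneg P hF hFc hFmeas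
  have hsub : Sᶜ ⊆ {s | ε ≤ φ s - ∫ s', φ s' ∂π} := by
    intro s hs
    simp only [hS, Set.mem_compl_iff, Set.mem_ofPred_eq, not_forall, not_le] at hs
    obtain ⟨f, hf, hlt⟩ := hs
    have h : risk P f - empRisk f s ≤ φ s :=
      le_ciSup (f := fun f : F ↦ risk P (f : X → Bool) - empRisk (f : X → Bool) s)
        (bddAbove_range_of_abs_le fun f ↦ abs_risk_sub_empRisk_le P _ s) ⟨f, hf⟩
    simp only [Set.mem_ofPred_eq]
    linarith
  have hlog : 0 ≤ Real.log (1 / δ) / (2 * n) :=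
    div_nonneg (Real.log_nonneg (one_le_one_div hδ0 hδ1)) (by positivity)
  have hbad : π.real Sᶜ ≤ δ := by
    refine (measureReal_mono hsub).trans
      (((hasSubgaussianMGF_iSup_risk_sub P hF hFc hFmeas n).measure_ge_le
        (Real.sqrt_nonneg _)).trans_eq ?_)
    have hexp : -ε ^ 2 / (2 * ((∑ _ : Fin n, (‖(1 / n : ℝ)‖₊ / 2) ^ 2 : NNReal) : ℝ))
        = Real.log δ := by
      rw [hε, Real.sq_sqrt hlog, one_div, Real.log_inv]
      simp only [Finset.sum_const, Finset.card_univ, Fintype.card_fin, nsmul_eq_mul,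
        NNReal.coe_mul, NNReal.coe_natCast, NNReal.coe_pow, NNReal.coe_div, coe_nnnorm,
        NNReal.coe_ofNat, Real.norm_of_nonneg (one_div_nonneg.2 hn'.le)]
      field_simp
    rw [hexp, Real.exp_log hδ0]
  have hcover : 1 ≤ π.real S + π.real Sᶜ := by
    simpa using measureReal_union_le (μ := π) S Sᶜ
  change 1 - δ ≤ π.real S
  linarith
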